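/- The GL_5-invariants of (QP_5)_23 vanish: every homogeneous polynomial f of degree 23 in P_5 such that g·f − f is hit for every g in GL_5(F_2) is itself hit. -/

import Mathlib

open MvPolynomial

noncomputable section

/-- The polynomial algebra `P_5 = F_2[x_1,...,x_5]`. -/
abbrev P5 : Type := MvPolynomial (Fin 5) (ZMod 2)

/-- The total Steenrod square: the `F_2`-algebra endomorphism with `Sq (x_i) = x_i + x_i ^ 2`. -/
def Sq : P5 →ₐ[ZMod 2] P5 := aeval fun i => X i + X i ^ 2

/-- `f` (homogeneous of degree `n`) is hit if it is the degree-`n` homogeneous component of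
`Sq g` for some `g` all of whose homogeneous components have degree `< n`. -/
def IsHit (n : ℕ) (f : P5) : Prop :=
  ∃ g : P5, (∀ m, n ≤ m → homogeneousComponent m g = 0) ∧
    f = homogeneousComponent n (Sq g)

/-- The subspace of hit polynomials of degree `n`. -/
def hitSpan (n : ℕ) : Submodule (ZMod 2) P5 :=
  Submodule.span (ZMod 2) {f : P5 | IsHit n f}

/-- The action of `GL_5(F_2)` on `P_5` by linear substitution of the variables. -/
def actGL (g : Matrix.GeneralLinearGroup (Fin 5) (ZMod 2)) : P5 →ₐ[ZMod 2] P5 :=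
  aeval fun i => ∑ j, ((g : Matrix (Fin 5) (Fin 5) (ZMod 2)) i j) • X j

/-- `wt d i` is the `(i+1)`-st entry `ω_{i+1}` of the weight vector of the monomial with
exponent vector `d`, i.e. the number of `j` such that bit `i` of `d j` is `1`. -/
def wt (d : Fin 5 →₀ ℕ) (i : ℕ) : ℕ :=
  (Finset.univ.filter fun j : Fin 5 => Nat.testBit (d j) i).card

/-- The weight vector of the exponent vector `d` equals the (finitely supported) list `w`. -/
def hasWt (d : Fin 5 →₀ ℕ) (w : List ℕ) : Prop :=
  ∀ i, wt d i = w.getD i 0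

/-- The weight vector of `d` is strictly smaller than `w` in left lexicographic order. -/
def wtLt (d : Fin 5 →₀ ℕ) (w : List ℕ) : Prop :=
  ∃ i, (∀ j, j < i → wt d j = w.getD j 0) ∧ wt d i < w.getD i 0

/-- `P_5^-(ω)`: the span of degree-`n` monomials whose weight vector is `< w`. -/
def PMinus (n : ℕ) (w : List ℕ) : Submodule (ZMod 2) P5 :=
  Submodule.span (ZMod 2)
    {x : P5 | ∃ d : Fin 5 →₀ ℕ, x = monomial d 1 ∧ (∑ j, d j) = n ∧ wtLt d w}

/-- `P_5(ω)`: the span of degree-`n` monomials whose weight vector is `≤ w`. -/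
def PLe (n : ℕ) (w : List ℕ) : Submodule (ZMod 2) P5 :=
  Submodule.span (ZMod 2)
    {x : P5 | ∃ d : Fin 5 →₀ ℕ, x = monomial d 1 ∧ (∑ j, d j) = n ∧ (wtLt d w ∨ hasWt d w)}

/-- The monomial `x_1^a x_2^b x_3^c x_4^d x_5^e`. -/
def mon (a b c d e : ℕ) : P5 :=
  X 0 ^ a * X 1 ^ b * X 2 ^ c * X 3 ^ d * X 4 ^ e


open Finset

/-! ### Exponent vectors and lists of monomials -/

/-- Exponent vectors of monomials in five variables, in a form the kernel evaluates quickly. -/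
abbrev Expo : Type := ℕ × ℕ × ℕ × ℕ × ℕ

namespace Expo

/-- Componentwise sum of exponent vectors. -/
def add : Expo → Expo → Expo
  | (a, b, c, d, e), (a', b', c', d', e') => (a + a', b + b', c + c', d + d', e + e')

/-- Twice an exponent vector. -/
def double : Expo → Expo
  | (a, b, c, d, e) => (2 * a, 2 * b, 2 * c, 2 * d, 2 * e)

/-- Cyclic rotation of an exponent vector, corresponding to `X j ↦ X (j + 1)`. -/
def rot : Expo → Expo
  | (a, b, c, d, e) => (e, a, b, c, d)

/-- Total degree. -/
def deg : Expo → ℕ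
  | (a, b, c, d, e) => a + b + c + d + e

/-- The weight of a monomial in which `X j` has weight `2 ^ j`. -/
def weight : Expo → ℕ
  | (a, b, c, d, e) => a + 2 * b + 4 * c + 8 * d + 16 * e

/-- The exponents as a function on the indices. -/
def get : Expo → Fin 5 → ℕ
  | (a, b, c, d, e) => ![a, b, c, d, e]

/-- An integer code of an exponent vector, used to compare rotations. -/
def code : Expo → ℕ
  | (a, b, c, d, e) => (((a * 32 + b) * 32 + c) * 32 + d) * 32 + e

/-- The exponent vector with the smaller code. -/
def least (m n : Expo) : Expo := bif Nat.ble m.code n.code then m else n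

/-- The rotation of an exponent vector with the smallest code. -/
def canon (m : Expo) : Expo :=
  least m (least m.rot (least m.rot.rot (least m.rot.rot.rot m.rot.rot.rot.rot)))

end Expo

/-- The product of two sums of monomials. -/
def mulList (L M : List Expo) : List Expo := L.flatMap fun a => M.map a.add

/-- The `d`-th power of a sum of monomials in characteristic two, for `d < 2 ^ n`. -/
def powList (L : List Expo) : ℕ → ℕ → List Expo
  | 0, _ => [(0, 0, 0, 0, 0)]
  | n + 1, d =>
    bif Nat.beq (d % 2) 1 then mulList L ((powList L n (d / 2)).map Expo.double)
    else (powList L n (d / 2)).map Expo.double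

/-- The image of a monomial under `X j ↦ X j + X (j - 1) ^ 2`. -/
def squareList : Expo → List Expo
  | (a, b, c, d, e) =>
    mulList (powList [(1, 0, 0, 0, 0), (0, 0, 0, 0, 2)] 5 a)
      (mulList (powList [(0, 1, 0, 0, 0), (2, 0, 0, 0, 0)] 5 b)
        (mulList (powList [(0, 0, 1, 0, 0), (0, 2, 0, 0, 0)] 5 c)
          (mulList (powList [(0, 0, 0, 1, 0), (0, 0, 2, 0, 0)] 5 d)
            (powList [(0, 0, 0, 0, 1), (0, 0, 0, 2, 0)] 5 e))))

/-- The terms of degree 23 in `squareList`. -/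
def hitTerms (m : Expo) : List Expo := (squareList m).filter fun t => Nat.beq t.deg 23

/-- Add a term to a sum modulo two. -/
def toggle (m : Expo) (L : List Expo) : List Expo := if m ∈ L then L.erase m else m :: L

/-- Add the orbits of the given terms to a sum, ignoring the orbits in `known`. -/
def reduceTerms (known : List Expo) : List Expo → List Expo → List Expo
  | [], acc => acc
  | t :: ts, acc =>
    reduceTerms known ts (if t.canon ∈ known then acc else toggle t.canon acc)

/-- The sum of the relations given by the monomials `ds`, modulo the known orbits. -/
def reduceHits (known : List Expo) : List Expo → List Expo → List Expo
  | [], acc => acc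
  | d :: ds, acc => reduceHits known ds (reduceTerms known (hitTerms d) acc)

/-- Enlarge the list of known orbits using relations that involve a single unknown orbit. -/
def closeOrbits : List (List Expo) → List Expo → List Expo
  | [], known => known
  | ds :: rest, known =>
    match reduceHits known ds [] with
    | [m] => closeOrbits rest (m :: known)
    | _ => closeOrbits rest known

/-- Eight orbits of monomials that span the coinvariants of the Singer normalizer. -/
def basisOrbits : List Expo :=
  [(1, 4, 6, 1, 11), (1, 2, 5, 6, 9), (0, 7, 5, 3, 8), (0, 7, 7, 0, 9), (0, 3, 9, 4, 7),
   (0, 1, 12, 3, 7), (1, 7, 1, 11, 3), (1, 3, 11, 3, 5)]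

/-- Monomials whose squares express all orbits of degree 23 through `basisOrbits`. -/
def relations : List (List Expo) :=
  [[(0, 0, 1, 13, 1)], [(0, 0, 3, 10, 2)], [(0, 0, 9, 1, 5)], [(0, 1, 0, 5, 9)],
   [(0, 1, 2, 2, 10)], [(0, 2, 0, 11, 2)], [(0, 2, 2, 8, 3)], [(0, 3, 1, 0, 11)],
   [(0, 9, 3, 2, 1)], [(1, 1, 4, 1, 8)], [(1, 2, 8, 1, 3)], [(0, 1, 0, 13, 5)],
   [(0, 8, 5, 1, 5)], [(1, 1, 4, 9, 4)], [(0, 4, 1, 6, 4), (0, 4, 9, 2, 4)], [(0, 1, 12, 1, 8)],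
   [(0, 6, 1, 1, 14)], [(0, 1, 10, 2, 8)], [(0, 4, 2, 1, 14)], [(0, 8, 3, 8, 2)],
   [(1, 1, 12, 1, 6)], [(0, 0, 0, 7, 12)], [(0, 0, 4, 1, 14)], [(0, 0, 11, 6, 2)],
   [(0, 0, 15, 0, 4)], [(0, 1, 6, 4, 8)], [(0, 5, 0, 6, 8)], [(1, 10, 2, 4, 2)],
   [(0, 0, 7, 10, 1)], [(0, 0, 9, 7, 2)], [(0, 0, 13, 1, 4)], [(0, 1, 0, 11, 6)],
   [(0, 2, 4, 11, 1)], [(0, 4, 3, 9, 2)], [(2, 5, 2, 5, 4)], [(1, 6, 4, 4, 2)],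
   [(0, 6, 2, 1, 6)], [(1, 2, 6, 4, 2)], [(0, 0, 7, 2, 5)], [(0, 2, 4, 3, 5)],
   [(0, 0, 4, 7, 11)], [(0, 0, 15, 6, 1)], [(0, 1, 6, 10, 5)], [(0, 3, 1, 14, 4)],
   [(0, 3, 5, 8, 6)], [(0, 4, 13, 2, 3)], [(0, 5, 2, 9, 6)], [(0, 5, 4, 6, 7)],
   [(0, 5, 6, 3, 8)], [(0, 7, 3, 4, 8)], [(0, 12, 3, 3, 4)], [(1, 2, 5, 4, 10)],
   [(0, 6, 6, 7, 2)], [(0, 7, 1, 5, 8)], [(0, 10, 2, 6, 3)], [(1, 1, 10, 4, 5)],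
   [(0, 4, 7, 7, 2)], [(0, 0, 13, 3, 3)], [(0, 3, 3, 5, 8)], [(0, 3, 5, 2, 9)],
   [(0, 5, 2, 3, 9)], [(0, 7, 1, 1, 10)], [(0, 15, 2, 1, 1)],
   [(1, 3, 3, 11, 3), (3, 3, 3, 3, 3), (1, 3, 3, 3, 7)], [(1, 4, 2, 3, 11)], [(1, 2, 3, 7, 9)],
   [(1, 2, 5, 2, 11)], [(0, 3, 7, 3, 8)], [(1, 7, 3, 4, 6)], [(2, 3, 7, 3, 4)],
   [(0, 7, 5, 1, 9)], [(0, 5, 2, 7, 7)], [(0, 7, 3, 2, 9)], [(1, 5, 2, 7, 5)],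
   [(0, 7, 1, 7, 7), (1, 7, 1, 7, 5), (1, 7, 5, 3, 6)],
   [(0, 2, 3, 3, 13), (2, 2, 3, 3, 9), (0, 3, 3, 9, 6)],
   [(0, 3, 7, 5, 7), (1, 3, 7, 5, 5), (1, 3, 7, 7, 4)], [(0, 3, 7, 5, 7)], [(1, 3, 9, 4, 5)],
   [(2, 7, 5, 5, 3)], [(0, 3, 3, 9, 6)], [(0, 3, 5, 6, 7)], [(1, 2, 3, 5, 10)],
   [(1, 3, 9, 2, 6)], [(1, 5, 6, 3, 6)], [(1, 9, 2, 2, 7)], [(2, 2, 3, 7, 7)],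
   [(0, 3, 3, 7, 7)], [(1, 3, 7, 3, 6)], [(2, 3, 7, 5, 3)], [(1, 3, 5, 4, 6)],
   [(1, 5, 2, 5, 6)], [(1, 5, 4, 2, 7)], [(2, 3, 5, 6, 3)], [(1, 1, 6, 2, 7)],
   [(1, 3, 1, 6, 6)], [(2, 3, 3, 3, 5)], [(1, 3, 5, 10, 3)], [(1, 1, 12, 3, 5)],
   [(1, 12, 3, 3, 2)], [(0, 1, 4, 7, 7)], [(0, 4, 7, 5, 3)], [(0, 4, 3, 7, 3)],
   [(1, 3, 7, 1, 7)], [(1, 3, 3, 11, 3)]]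

/-- The orbits that `relations` reduces to `basisOrbits`. -/
def knownOrbits : List Expo := closeOrbits relations basisOrbits

/-- All monomials of degree 23 and weight divisible by 31 lie in known orbits. -/
def knownOrbitsComplete (known : List Expo) : Bool :=
  (List.range 24).all fun a => (List.range (24 - a)).all fun b =>
    (List.range (24 - a - b)).all fun c => (List.range (24 - a - b - c)).all fun d =>
      let m : Expo := (a, b, c, d, 23 - a - b - c - d)
      bif Nat.beq (m.weight % 31) 0 then decide (m.canon ∈ known) else true

theorem knownOrbitsComplete_knownOrbits : knownOrbitsComplete knownOrbits = true := by
  decide +kernel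

/-! ### Powers of a root of `z ^ 5 = z ^ 2 + 1` -/

/-- The coordinates of `ζ ^ a` in the basis `1, ζ, ..., ζ ^ 4`, as a bit mask. -/
def zetaPow (a : ℕ) : ℕ :=
  26123046934389750782758618732681130701236736065 / 32 ^ (a % 31) % 32

/-- The bit mask of a sum of powers of `ζ`. -/
def zetaSum : List ℕ → ℕ
  | [] => 0
  | a :: L => zetaPow a ^^^ zetaSum L

/-- The coefficient of `X ^ e` in `∏ (j, b), ∑ k, ζ ^ (l k * 2 ^ (j + b)) * X k ^ 2 ^ b`, as a
list of exponents of `ζ`. -/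
def coeffList (l : Expo) : List (ℕ × ℕ) → Expo → List ℕ
  | [], e => bif Nat.beq e.deg 0 then [0] else []
  | (j, b) :: fs, (e₀, e₁, e₂, e₃, e₄) =>
    let q := 2 ^ b
    let s := 2 ^ (j + b)
    (bif Nat.ble q e₀ then (coeffList l fs (e₀ - q, e₁, e₂, e₃, e₄)).map (l.1 * s + ·) else []) ++
    ((bif Nat.ble q e₁ then
      (coeffList l fs (e₀, e₁ - q, e₂, e₃, e₄)).map (l.2.1 * s + ·) else []) ++
    ((bif Nat.ble q e₂ then
      (coeffList l fs (e₀, e₁, e₂ - q, e₃, e₄)).map (l.2.2.1 * s + ·) else []) ++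
    ((bif Nat.ble q e₃ then
      (coeffList l fs (e₀, e₁, e₂, e₃ - q, e₄)).map (l.2.2.2.1 * s + ·) else []) ++
    (bif Nat.ble q e₄ then
      (coeffList l fs (e₀, e₁, e₂, e₃, e₄ - q)).map (l.2.2.2.2 * s + ·) else []))))

/-- The factor `(j, b)` if `a` is odd. -/
def oddFactor (j b a : ℕ) : List (ℕ × ℕ) := bif Nat.beq (a % 2) 1 then [(j, b)] else []

/-- The pairs `(j, i + b)` for the nonzero binary digits `2 ^ i` of the `j`-th exponent, for
exponents below `2 ^ n`, with the high digits first. -/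
def digitList : ℕ → ℕ → Expo → List (ℕ × ℕ)
  | 0, _, _ => []
  | n + 1, i, (a, b, c, d, e) =>
    digitList n (i + 1) (a / 2, b / 2, c / 2, d / 2, e / 2) ++ (oddFactor 0 i a ++
      (oddFactor 1 i b ++ (oddFactor 2 i c ++ (oddFactor 3 i d ++ oddFactor 4 i e))))

/-- The coefficient of `X ^ e` in the image of the orbit sum of `m` under the frame `l`. -/
def orbitCoeffList (l e m : Expo) : List ℕ :=
  coeffList l (digitList 5 0 m) e ++ (coeffList l (digitList 5 0 m.rot) e ++
    (coeffList l (digitList 5 0 m.rot.rot) e ++ (coeffList l (digitList 5 0 m.rot.rot.rot) e ++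
      coeffList l (digitList 5 0 m.rot.rot.rot.rot) e)))

/-- Bases `ζ ^ l k` of the span of `1, ζ, ..., ζ ^ 4`, with the inverse of the coordinate matrix
and a bit mask recording the coefficients of `(15, 7, 1, 0, 0)` on `basisOrbits`. -/
def framesThree : List (Expo × Expo × ℕ) :=
  [((0, 1, 3, 2, 4), (1, 2, 8, 4, 16), 45),
   ((0, 2, 1, 3, 4), (1, 4, 2, 8, 16), 142),
   ((0, 7, 2, 1, 3), (1, 16, 20, 2, 8), 79),
   ((0, 3, 1, 2, 4), (1, 8, 2, 4, 16), 139),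
   ((0, 3, 4, 1, 2), (1, 8, 16, 2, 4), 6),
   ((0, 6, 1, 2, 4), (1, 8, 10, 4, 16), 141),
   ((0, 12, 3, 1, 4), (1, 4, 12, 6, 16), 189)]

/-- As `framesThree`, with the coefficients of `(15, 3, 3, 1, 1)`. -/
def framesFive : List (Expo × Expo × ℕ) :=
  [((0, 2, 4, 1, 9), (1, 4, 24, 10, 8), 64),
   ((0, 1, 7, 2, 9), (1, 10, 24, 28, 8), 192),
   ((0, 10, 1, 3, 2), (17, 16, 2, 8, 4), 128)]

/-- The recorded coefficients of `e` on `basisOrbits` are correct. -/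
def checkFrames (e : Expo) (F : List (Expo × Expo × ℕ)) : Bool :=
  F.all fun f => (List.range 8).all fun i =>
    Nat.beq (zetaSum (orbitCoeffList f.1 e (basisOrbits.getD i 0))) (f.2.2 / 2 ^ i % 2)

theorem checkFrames_framesThree : checkFrames (15, 7, 1, 0, 0) framesThree = true := by
  decide +kernel

theorem checkFrames_framesFive : checkFrames (15, 3, 3, 1, 1) framesFive = true := by
  decide +kernel

section Field

variable {K : Type*} [Field K] [CharP K 2]

/-- The element of `K` with the given bit mask of coordinates in `1, ζ, ..., ζ ^ 4`. -/
def maskEval (ζ : K) (n : ℕ) : K := ∑ i ∈ range 5, if n.testBit i then ζ ^ i else 0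

theorem maskEval_xor (ζ : K) (m n : ℕ) :
    maskEval ζ (m ^^^ n) = maskEval ζ m + maskEval ζ n := by
  have key : ∀ i, (m ^^^ n).testBit i = (m.testBit i ^^ n.testBit i) :=
    fun i => Nat.testBit_xor m n i
  simp only [maskEval, ← sum_add_distrib, key]
  refine sum_congr rfl fun i _ => ?_
  cases m.testBit i <;> cases n.testBit i <;> simp [CharTwo.add_self_eq_zero]

theorem maskEval_zetaPow {ζ : K} (hζ : ζ ^ 5 = ζ ^ 2 + 1) (a : ℕ) :
    maskEval ζ (zetaPow a) = ζ ^ a := by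
  have hstep : ∀ n < 32, maskEval ζ (if 32 ≤ 2 * n then (2 * n) ^^^ 37 else 2 * n) =
      ζ * maskEval ζ n := by
    intro n hn
    have h2 : (2 : K) = 0 := CharTwo.two_eq_zero
    interval_cases n <;> simp [maskEval, sum_range_succ, Nat.testBit] <;>
      ring_nf <;> (try rw [hζ]) <;> (try ring_nf) <;> (try simp [h2])
  have hlt : ∀ r < 31, zetaPow r < 32 ∧ zetaPow (r + 1) =
      if 32 ≤ 2 * zetaPow r then (2 * zetaPow r) ^^^ 37 else 2 * zetaPow r := by
    decide +kernel
  have hmod : ∀ b, zetaPow (b % 31) = zetaPow b := fun b => by simp [zetaPow]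
  have hmod' : ∀ b, zetaPow (b % 31 + 1) = zetaPow (b + 1) := fun b => by simp [zetaPow]
  induction a with
  | zero => simp [zetaPow, maskEval, sum_range_succ, Nat.testBit]
  | succ a ih =>
    obtain ⟨h1, h2⟩ := hlt (a % 31) (Nat.mod_lt _ (by norm_num))
    rw [hmod] at h1 h2
    rw [hmod'] at h2
    rw [h2, hstep _ h1, ih, pow_succ']

theorem sum_map_zeta_pow {ζ : K} (hζ : ζ ^ 5 = ζ ^ 2 + 1) (L : List ℕ) :
    (L.map (ζ ^ ·)).sum = maskEval ζ (zetaSum L) := by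
  induction L with
  | nil => simp [zetaSum, maskEval]
  | cons a L ih => simp [zetaSum, maskEval_xor, maskEval_zetaPow hζ, ih]

theorem zeta_pow_eq {ζ : K} (hζ : ζ ^ 5 = ζ ^ 2 + 1) {a b : ℕ} (h : zetaPow a = zetaPow b) :
    ζ ^ a = ζ ^ b := by
  rw [← maskEval_zetaPow hζ, h, maskEval_zetaPow hζ]

theorem orderOf_zeta {ζ : K} (hζ : ζ ^ 5 = ζ ^ 2 + 1) : orderOf ζ = 31 := by
  have : Fact (Nat.Prime 31) := ⟨by norm_num⟩
  refine orderOf_eq_prime ?_ ?_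
  · rw [zeta_pow_eq hζ (b := 0) (by decide +kernel), pow_zero]
  · rintro rfl
    simp at hζ

/-! ### Monomials -/

namespace Expo

variable (K) in
/-- The monomial with the given exponents. -/
def mono (m : Expo) : MvPolynomial (Fin 5) K := ∏ j, X j ^ m.get j

/-- The exponents as a finitely supported function. -/
def toFinsupp (m : Expo) : Fin 5 →₀ ℕ := Finsupp.equivFunOnFinite.symm m.get

omit [CharP K 2] in
theorem mono_eq (m : Expo) : mono K m = monomial m.toFinsupp 1 := by
  rw [MvPolynomial.monomial_eq, Finsupp.prod_fintype _ _ (by simp)]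
  simp [mono, toFinsupp]

omit [CharP K 2] in
theorem mono_add (m n : Expo) : mono K (m.add n) = mono K m * mono K n := by
  simp [mono, add, get, Fin.prod_univ_five, pow_add]
  ring

omit [CharP K 2] in
theorem mono_double (m : Expo) : mono K m.double = mono K m ^ 2 := by
  simp [mono, double, get, Fin.prod_univ_five]
  ring

theorem degree_toFinsupp (m : Expo) : m.toFinsupp.degree = m.deg := by
  simp [Finsupp.degree_eq_sum, toFinsupp, Fin.sum_univ_five, get, deg]

omit [CharP K 2] in
theorem isHomogeneous_mono (m : Expo) : (mono K m).IsHomogeneous m.deg := by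
  rw [mono_eq]
  exact isHomogeneous_monomial _ (degree_toFinsupp m)

end Expo

variable (K) in
/-- The sum of a list of monomials. -/
def polyOfList (L : List Expo) : MvPolynomial (Fin 5) K := (L.map (Expo.mono K)).sum

omit [CharP K 2] in
theorem polyOfList_mulList (L M : List Expo) :
    polyOfList K (mulList L M) = polyOfList K L * polyOfList K M := by
  have h : ∀ a : Expo, ((M.map a.add).map (Expo.mono K)).sum =
      Expo.mono K a * (M.map (Expo.mono K)).sum := by
    intro a
    rw [← List.sum_map_mul_left, List.map_map]
    simp only [Function.comp_def, Expo.mono_add]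
  induction L with
  | nil => simp [polyOfList, mulList]
  | cons a L ih =>
    simp only [polyOfList, mulList, List.flatMap_cons, List.map_append, List.sum_append, h,
      List.map_cons, List.sum_cons, add_mul] at ih ⊢
    rw [ih]

theorem polyOfList_map_double (L : List Expo) :
    polyOfList K (L.map Expo.double) = polyOfList K L ^ 2 := by
  induction L with
  | nil => simp [polyOfList]
  | cons a L ih =>
    simp only [polyOfList, List.map_cons, List.sum_cons, Expo.mono_double, CharTwo.add_sq] at ih ⊢
    rw [ih]

theorem polyOfList_powList (L : List Expo) (n d : ℕ) (hd : d < 2 ^ n) :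
    polyOfList K (powList L n d) = polyOfList K L ^ d := by
  induction n generalizing d with
  | zero =>
    obtain rfl : d = 0 := by simpa using hd
    simp [powList, polyOfList, Expo.mono, Expo.get, Fin.prod_univ_five]
  | succ n ih =>
    have h := ih (d / 2) (by rw [pow_succ] at hd; lia)
    rcases Nat.mod_two_eq_zero_or_one d with h0 | h0
    · have hd2 : d = d / 2 * 2 := by lia
      conv_rhs => rw [hd2]
      simp [powList, h0, polyOfList_map_double, h, pow_mul, Nat.beq]
    · have hd2 : d = d / 2 * 2 + 1 := by lia
      conv_rhs => rw [hd2]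
      simp [powList, h0, polyOfList_map_double, polyOfList_mulList, h, pow_mul, pow_succ']

/-! ### Steenrod squares over an extension field -/

variable (K) in
/-- The total Steenrod square over `K`. -/
def squareMap : MvPolynomial (Fin 5) K →ₐ[K] MvPolynomial (Fin 5) K :=
  aeval fun i => X i + X i ^ 2

variable (K) in
/-- The total Steenrod square in coordinates diagonalizing a Singer cycle. -/
def twistedSquareMap : MvPolynomial (Fin 5) K →ₐ[K] MvPolynomial (Fin 5) K :=
  aeval fun j => X j + X (j - 1) ^ 2

theorem polyOfList_squareList (m : Expo) (hm : m.deg < 32) :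
    polyOfList K (squareList m) = twistedSquareMap K (m.mono K) := by
  obtain ⟨a, b, c, d, e⟩ := m
  simp only [Expo.deg] at hm
  simp only [squareList, polyOfList_mulList]
  repeat rw [polyOfList_powList _ _ _ (by norm_num; lia)]
  have e2 : (2 : Fin 5) - 1 = 1 := rfl
  have e3 : (3 : Fin 5) - 1 = 2 := rfl
  have e4 : (4 : Fin 5) - 1 = 3 := rfl
  have e0 : (-1 : Fin 5) = 4 := rfl
  simp [polyOfList, Expo.mono, Expo.get, Fin.prod_univ_five, twistedSquareMap, e0, e2, e3, e4]
  ring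

variable (K) in
/-- The hit polynomials of degree 23 over `K`. -/
def hitSubmodule : Submodule K (MvPolynomial (Fin 5) K) :=
  Submodule.span K {u | ∃ d : Fin 5 →₀ ℕ, d.degree < 23 ∧
    u = homogeneousComponent 23 (squareMap K (monomial d 1))}

omit [CharP K 2] in
theorem homogeneousComponent_squareMap_mem (g : MvPolynomial (Fin 5) K)
    (hg : ∀ d ∈ g.support, d.degree < 23) :
    homogeneousComponent 23 (squareMap K g) ∈ hitSubmodule K := by
  rw [g.as_sum, map_sum, map_sum]
  refine Submodule.sum_mem _ fun d hd => ?_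
  have : monomial d (coeff d g) = coeff d g • monomial d (1 : K) := by simp [smul_monomial]
  rw [this, map_smul, map_smul]
  exact Submodule.smul_mem _ _ (Submodule.subset_span ⟨d, hg d hd, rfl⟩)

end Field

section Frame

variable {K : Type*} [Field K]

/-! ### Substitutions given by frames -/

/-- The substitution of the linear forms `∑ k, q k ^ 2 ^ j * X k`. -/
def frameMap (q : Fin 5 → K) : MvPolynomial (Fin 5) K →ₐ[K] MvPolynomial (Fin 5) K :=
  aeval fun j => ∑ k, C (q k ^ 2 ^ (j : ℕ)) * X k

theorem frameMap_mono (q : Fin 5 → K) (m : Expo) :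
    frameMap q (m.mono K) = ∏ j : Fin 5, (∑ k, C (q k ^ 2 ^ (j : ℕ)) * X k) ^ m.get j := by
  simp only [frameMap, Expo.mono, map_prod, map_pow, aeval_X]

theorem isHomogeneous_frameMap (q : Fin 5 → K) {p : MvPolynomial (Fin 5) K} {n : ℕ}
    (hp : p.IsHomogeneous n) : (frameMap q p).IsHomogeneous n := by
  have h : ∀ j : Fin 5, (∑ k, C (q k ^ 2 ^ (j : ℕ)) * X k).IsHomogeneous 1 := fun j =>
    IsHomogeneous.sum _ _ _ fun k _ => isHomogeneous_C_mul_X _ _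
  have h' := hp.aeval _ h
  rwa [one_mul] at h'

theorem frameMap_smul_mono (c : K) (q : Fin 5 → K) (m : Expo) :
    frameMap (c • q) (m.mono K) = c ^ m.weight • frameMap q (m.mono K) := by
  have h : ∀ j : Fin 5, (∑ k, C ((c • q) k ^ 2 ^ (j : ℕ)) * X k : MvPolynomial (Fin 5) K) =
      C (c ^ 2 ^ (j : ℕ)) * ∑ k, C (q k ^ 2 ^ (j : ℕ)) * X k := by
    intro j
    simp only [Pi.smul_apply, smul_eq_mul, mul_pow, C_mul, mul_sum, mul_assoc]
  obtain ⟨m₀, m₁, m₂, m₃, m₄⟩ := m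
  simp only [frameMap_mono, h, mul_pow, prod_mul_distrib, smul_eq_C_mul]
  congr 1
  simp [Fin.prod_univ_five, Expo.get, Expo.weight, ← pow_mul, pow_add]

theorem frameMap_rot (q : Fin 5 → K) (hq : ∀ k, q k ^ 32 = q k) (m : Expo) :
    frameMap q (m.rot.mono K) = frameMap (fun k => q k ^ 2) (m.mono K) := by
  obtain ⟨m₀, m₁, m₂, m₃, m₄⟩ := m
  simp only [frameMap_mono, ← pow_mul, Fin.prod_univ_five (M := MvPolynomial (Fin 5) K)]
  simp only [Expo.get, Expo.rot, Matrix.cons_val, Fin.coe_ofNat_eq_mod]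
  norm_num [hq]
  ring

theorem frameMap_twistedSquareMap [CharP K 2] (q : Fin 5 → K) (hq : ∀ k, q k ^ 32 = q k)
    (p : MvPolynomial (Fin 5) K) :
    frameMap q (twistedSquareMap K p) = squareMap K (frameMap q p) := by
  have key : (frameMap q).comp (twistedSquareMap K) = (squareMap K).comp (frameMap q) := by
    refine MvPolynomial.algHom_ext fun j => ?_
    simp only [AlgHom.comp_apply, twistedSquareMap, squareMap, frameMap, aeval_X, map_add,
      map_sum, map_mul, algHom_C, map_pow (aeval _), CharTwo.sum_sq, mul_pow, ← sum_add_distrib,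
      mul_add, algebraMap_eq, ← map_pow C, ← pow_mul]
    refine sum_congr rfl fun k _ => ?_
    have e0 : (-1 : Fin 5) = 4 := rfl
    have e2 : (2 : Fin 5) - 1 = 1 := rfl
    have e3 : (3 : Fin 5) - 1 = 2 := rfl
    have e4 : (4 : Fin 5) - 1 = 3 := rfl
    fin_cases j <;> simp [e0, e2, e3, e4, hq]
  exact DFunLike.congr_fun key p

variable [CharP K 2] [Algebra (ZMod 2) K]

/-- `q` is the image of the basis `1, ζ, ..., ζ ^ 4` under an element of `GL_5(F_2)`. -/
def IsFrame (ζ : K) (q : Fin 5 → K) : Prop :=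
  ∃ g : Matrix.GeneralLinearGroup (Fin 5) (ZMod 2),
    ∀ k, q k = ∑ i, algebraMap (ZMod 2) K (g.1 k i) * ζ ^ (i : ℕ)

/-- The matrix whose rows are given by bit masks. -/
def bitMatrix (v : Fin 5 → ℕ) : Matrix (Fin 5) (Fin 5) (ZMod 2) :=
  .of fun k i => if (v k).testBit i then 1 else 0

theorem isFrame_sum {ζ : K} (hζ : ζ ^ 5 = ζ ^ 2 + 1)
    (g : Matrix.GeneralLinearGroup (Fin 5) (ZMod 2)) (l n : Expo)
    (h : bitMatrix (fun k => zetaPow (l.get k)) * (bitMatrix n.get).transpose = 1) :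
    IsFrame ζ fun k => ∑ i, algebraMap (ZMod 2) K (g.1 k i) * ζ ^ l.get i := by
  refine ⟨g * ⟨_, _, h, mul_eq_one_comm.mp h⟩, fun k => ?_⟩
  have hl : ∀ i, ζ ^ l.get i =
      ∑ j : Fin 5, algebraMap (ZMod 2) K (bitMatrix (fun k => zetaPow (l.get k)) i j) *
        ζ ^ (j : ℕ) := by
    intro i
    rw [← maskEval_zetaPow hζ, maskEval, sum_range]
    refine sum_congr rfl fun j _ => ?_
    simp only [bitMatrix, Matrix.of_apply]
    split_ifs <;> simp
  simp only [hl, mul_sum, Units.val_mul, Matrix.mul_apply, map_sum, map_mul, sum_mul, mul_assoc]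
  rw [sum_comm]

theorem isFrame_pow {ζ : K} (hζ : ζ ^ 5 = ζ ^ 2 + 1) (l n : Expo)
    (h : bitMatrix (fun k => zetaPow (l.get k)) * (bitMatrix n.get).transpose = 1) :
    IsFrame ζ fun k => ζ ^ l.get k := by
  have := isFrame_sum hζ 1 l n h
  simpa [Matrix.one_apply] using this

omit [Algebra (ZMod 2) K] in
theorem zeta_pow_thirtyOne {ζ : K} (hζ : ζ ^ 5 = ζ ^ 2 + 1) : ζ ^ 31 = 1 := by
  rw [← orderOf_zeta hζ, pow_orderOf_eq_one]

omit [CharP K 2] in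
theorem algebraMap_pow (a : ZMod 2) {n : ℕ} (hn : n ≠ 0) :
    algebraMap (ZMod 2) K a ^ n = algebraMap (ZMod 2) K a := by
  obtain rfl | rfl : a = 0 ∨ a = 1 := by decide +revert
  · simp [hn]
  · simp

theorem IsFrame.pow_eq {ζ : K} (hζ : ζ ^ 5 = ζ ^ 2 + 1) {q : Fin 5 → K} (hq : IsFrame ζ q)
    (k : Fin 5) : q k ^ 32 = q k := by
  obtain ⟨g, hg⟩ := hq
  have h31 := zeta_pow_thirtyOne hζ
  rw [hg, show 32 = 2 ^ 5 by norm_num, sum_pow_char_pow]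
  refine sum_congr rfl fun i _ => ?_
  rw [mul_pow, algebraMap_pow _ (by norm_num), ← pow_mul, mul_comm, mul_comm (i : ℕ), pow_mul]
  rw [show ζ ^ 2 ^ 5 = ζ ^ 31 * ζ by ring, h31, one_mul, mul_comm]

theorem IsFrame.sq {ζ : K} (hζ : ζ ^ 5 = ζ ^ 2 + 1) {q : Fin 5 → K} (hq : IsFrame ζ q) :
    IsFrame ζ fun k => q k ^ 2 := by
  obtain ⟨g, hg⟩ := hq
  convert isFrame_sum hζ g (0, 2, 4, 6, 8) (11, 14, 16, 2, 10) (by decide +kernel) using 2 with k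
  rw [hg, CharTwo.sum_sq]
  refine sum_congr rfl fun i _ => ?_
  rw [mul_pow, algebraMap_pow _ (by norm_num), ← pow_mul]
  fin_cases i <;> simp [Expo.get]

theorem IsFrame.smul {ζ : K} (hζ : ζ ^ 5 = ζ ^ 2 + 1) {q : Fin 5 → K} (hq : IsFrame ζ q) :
    IsFrame ζ (ζ • q) := by
  obtain ⟨g, hg⟩ := hq
  convert isFrame_sum hζ g (1, 2, 3, 4, 5) (2, 5, 8, 16, 1) (by decide +kernel) using 1
  ext k
  rw [Pi.smul_apply, hg, smul_eq_mul, mul_sum]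
  refine sum_congr rfl fun i _ => ?_
  rw [mul_left_comm, ← pow_succ']
  fin_cases i <;> simp [Expo.get]

theorem IsFrame.pow_smul {ζ : K} (hζ : ζ ^ 5 = ζ ^ 2 + 1) {q : Fin 5 → K} (hq : IsFrame ζ q)
    (n : ℕ) : IsFrame ζ (ζ ^ n • q) := by
  induction n with
  | zero => simpa using hq
  | succ n ih => simpa [pow_succ', mul_smul] using ih.smul hζ

end Frame

section Orbit

variable {K : Type*} [Field K]

/-! ### Orbit sums -/

variable (K) in
/-- The sum of the monomials obtained by rotating the exponents. -/
def orbit (m : Expo) : MvPolynomial (Fin 5) K :=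
  m.mono K + m.rot.mono K + m.rot.rot.mono K + m.rot.rot.rot.mono K + m.rot.rot.rot.rot.mono K

variable (K) in
/-- The sum of the orbits of a list of monomials. -/
def orbitSum (L : List Expo) : MvPolynomial (Fin 5) K := (L.map (orbit K)).sum

theorem orbitSum_nil : orbitSum K [] = 0 := by simp [orbitSum]

theorem orbitSum_cons (m : Expo) (L : List Expo) :
    orbitSum K (m :: L) = orbit K m + orbitSum K L := by simp [orbitSum]

theorem orbit_rot (m : Expo) : orbit K m.rot = orbit K m := by
  have h : m.rot.rot.rot.rot.rot = m := rfl
  simp only [orbit, h]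
  ring

theorem Expo.least_eq (m n : Expo) : m.least n = m ∨ m.least n = n := by
  unfold Expo.least
  cases Nat.ble m.code n.code <;> simp

theorem orbit_least {m n m' : Expo} (hm : orbit K m = orbit K m') (hn : orbit K n = orbit K m') :
    orbit K (m.least n) = orbit K m' := by
  obtain h | h := m.least_eq n
  · exact (congrArg (orbit K) h).trans hm
  · exact (congrArg (orbit K) h).trans hn

theorem orbit_canon (m : Expo) : orbit K m.canon = orbit K m := by
  have h₁ : orbit K m.rot = orbit K m := orbit_rot m
  have h₂ : orbit K m.rot.rot = orbit K m := (orbit_rot _).trans h₁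
  have h₃ : orbit K m.rot.rot.rot = orbit K m := (orbit_rot _).trans h₂
  have h₄ : orbit K m.rot.rot.rot.rot = orbit K m := (orbit_rot _).trans h₃
  exact orbit_least rfl (orbit_least h₁ (orbit_least h₂ (orbit_least h₃ h₄)))

theorem orbitSum_toggle [CharP K 2] (m : Expo) (L : List Expo) :
    orbitSum K (toggle m L) = orbit K m + orbitSum K L := by
  unfold toggle
  split_ifs with h
  · have h' : orbitSum K L = orbitSum K (m :: L.erase m) :=
      ((List.perm_cons_erase h).map _).sum_eq
    rw [h', orbitSum_cons, ← add_assoc, CharTwo.add_self_eq_zero, zero_add]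
  · rw [orbitSum_cons]

section Reduction

variable [CharP K 2] {W : Submodule K (MvPolynomial (Fin 5) K)} {known : List Expo}

theorem reduceTerms_sub_mem (hk : ∀ m ∈ known, orbit K m ∈ W) (L acc : List Expo) :
    orbitSum K (reduceTerms known L acc) - (orbitSum K L + orbitSum K acc) ∈ W := by
  induction L generalizing acc with
  | nil => simp [reduceTerms, orbitSum_nil]
  | cons t L ih =>
    rw [reduceTerms, orbitSum_cons]
    split_ifs with h
    · have h' := W.sub_mem (ih acc) (orbit_canon (K := K) t ▸ hk _ h)
      convert h' using 1
      abel
    · convert ih (toggle t.canon acc) using 2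
      rw [orbitSum_toggle, orbit_canon]
      abel

theorem reduceHits_sub_mem (hk : ∀ m ∈ known, orbit K m ∈ W) (L acc : List Expo)
    (hL : ∀ d ∈ L, orbitSum K (hitTerms d) ∈ W) :
    orbitSum K (reduceHits known L acc) - orbitSum K acc ∈ W := by
  induction L generalizing acc with
  | nil => simp [reduceHits]
  | cons t L ih =>
    rw [reduceHits]
    have h₁ := ih (reduceTerms known (hitTerms t) acc) fun d hd => hL d (.tail _ hd)
    have h₂ := reduceTerms_sub_mem hk (hitTerms t) acc
    convert W.add_mem (W.add_mem h₁ h₂) (hL t List.mem_cons_self) using 1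
    abel

theorem closeOrbits_mem (R : List (List Expo)) (hk : ∀ m ∈ known, orbit K m ∈ W)
    (hR : ∀ L ∈ R, ∀ d ∈ L, orbitSum K (hitTerms d) ∈ W) :
    ∀ m ∈ closeOrbits R known, orbit K m ∈ W := by
  induction R generalizing known with
  | nil => simpa [closeOrbits] using hk
  | cons L R ih =>
    have hR' : ∀ L ∈ R, ∀ d ∈ L, orbitSum K (hitTerms d) ∈ W := fun M hM => hR M (.tail _ hM)
    rw [closeOrbits]
    split
    · next m hm =>
      refine ih ?_ hR'
      have h := reduceHits_sub_mem hk L [] (hR L List.mem_cons_self)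
      rw [hm, orbitSum_cons, orbitSum_nil, add_zero, sub_zero] at h
      exact List.forall_mem_cons.mpr ⟨h, hk⟩
    · exact ih hk hR'

end Reduction

variable [CharP K 2] [Algebra (ZMod 2) K]

/-! ### Polynomials that become hit in every frame -/

/-- The polynomials whose images under all frames are hit. -/
def frameKernel (ζ : K) : Submodule K (MvPolynomial (Fin 5) K) :=
  ⨅ (q : Fin 5 → K) (_ : IsFrame ζ q), (hitSubmodule K).comap (frameMap q).toLinearMap

omit [CharP K 2] in
theorem mem_frameKernel {ζ : K} {p : MvPolynomial (Fin 5) K} :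
    p ∈ frameKernel ζ ↔ ∀ q, IsFrame ζ q → frameMap q p ∈ hitSubmodule K := by
  simp [frameKernel]

theorem frameMap_orbit {ζ : K} (hζ : ζ ^ 5 = ζ ^ 2 + 1) {q : Fin 5 → K} (hq : IsFrame ζ q)
    (m : Expo) :
    frameMap q (orbit K m) = ∑ j ∈ range 5, frameMap (fun k => q k ^ 2 ^ j) (m.mono K) := by
  have h₁ := hq.sq hζ
  have h₂ := h₁.sq hζ
  have h₃ := h₂.sq hζ
  simp only [orbit, map_add, frameMap_rot _ (hq.pow_eq hζ), frameMap_rot _ (h₁.pow_eq hζ),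
    frameMap_rot _ (h₂.pow_eq hζ), frameMap_rot _ (h₃.pow_eq hζ)]
  simp only [← pow_mul, sum_range_succ]
  norm_num

theorem IsFrame.pow_two_pow {ζ : K} (hζ : ζ ^ 5 = ζ ^ 2 + 1) {q : Fin 5 → K} (hq : IsFrame ζ q)
    (j : ℕ) : IsFrame ζ fun k => q k ^ 2 ^ j := by
  induction j with
  | zero => simpa using hq
  | succ j ih => simpa only [pow_succ, pow_mul, pow_one, pow_zero, one_mul] using ih.sq hζ

omit [CharP K 2] [Algebra (ZMod 2) K] in
theorem homogeneousComponent_frameMap_polyOfList (q : Fin 5 → K) (L : List Expo) :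
    homogeneousComponent 23 (frameMap q (polyOfList K L)) =
      frameMap q (polyOfList K (L.filter fun t => Nat.beq t.deg 23)) := by
  induction L with
  | nil => simp [polyOfList]
  | cons t L ih =>
    simp only [polyOfList, List.map_cons, List.sum_cons, map_add] at ih ⊢
    rw [ih, homogeneousComponent_of_mem (isHomogeneous_frameMap q t.isHomogeneous_mono)]
    split_ifs with h
    · rw [List.filter_cons_of_pos (by simpa using h.symm), List.map_cons, List.sum_cons, map_add]
    · rw [List.filter_cons_of_neg (by simpa using Ne.symm h), zero_add]

theorem polyOfList_hitTerms_mem {ζ : K} (hζ : ζ ^ 5 = ζ ^ 2 + 1) (d : Expo) (hd : d.deg < 23) :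
    polyOfList K (hitTerms d) ∈ frameKernel ζ := by
  rw [mem_frameKernel]
  intro q hq
  rw [hitTerms, ← homogeneousComponent_frameMap_polyOfList, polyOfList_squareList d (by lia),
    frameMap_twistedSquareMap q (hq.pow_eq hζ)]
  refine homogeneousComponent_squareMap_mem _ fun e he => ?_
  have h := isHomogeneous_frameMap q (d.isHomogeneous_mono (K := K)) (mem_support_iff.mp he)
  refine lt_of_eq_of_lt ?_ hd
  rw [Finsupp.degree_eq_weight_one]
  exact h

theorem frameMap_orbitSum {ζ : K} (hζ : ζ ^ 5 = ζ ^ 2 + 1) {q : Fin 5 → K} (hq : IsFrame ζ q)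
    (L : List Expo) : frameMap q (orbitSum K L) =
      ∑ j ∈ range 5, frameMap (fun k => q k ^ 2 ^ j) (polyOfList K L) := by
  induction L with
  | nil => simp [orbitSum, polyOfList]
  | cons t L ih =>
    simp only [orbitSum_cons, polyOfList, List.map_cons, List.sum_cons, map_add,
      sum_add_distrib, frameMap_orbit hζ hq] at ih ⊢
    rw [ih]

theorem orbitSum_hitTerms_mem {ζ : K} (hζ : ζ ^ 5 = ζ ^ 2 + 1) (d : Expo) (hd : d.deg < 23) :
    orbitSum K (hitTerms d) ∈ frameKernel ζ := by
  rw [mem_frameKernel]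
  intro q hq
  rw [frameMap_orbitSum hζ hq]
  exact sum_mem fun j _ =>
    mem_frameKernel.mp (polyOfList_hitTerms_mem hζ d hd) _ (hq.pow_two_pow hζ j)

theorem orbit_mem_span_sup {ζ : K} (hζ : ζ ^ 5 = ζ ^ 2 + 1) (m : Expo) (hm : m.deg = 23)
    (hw : 31 ∣ m.weight) :
    orbit K m ∈ Submodule.span K (Set.range fun i : Fin 8 => orbit K (basisOrbits.getD i 0)) ⊔
      frameKernel ζ := by
  have hknown : m.canon ∈ knownOrbits := by
    obtain ⟨a, b, c, d, e⟩ := m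
    have h := knownOrbitsComplete_knownOrbits
    simp only [Expo.deg] at hm
    simp only [knownOrbitsComplete, List.all_eq_true, List.mem_range] at h
    have h' := h a (by lia) b (by lia) c (by lia) d (by lia)
    rw [show 23 - a - b - c - d = e by lia, Nat.mod_eq_zero_of_dvd hw] at h'
    simpa using h'
  rw [← orbit_canon]
  refine closeOrbits_mem relations ?_ ?_ _ hknown
  · have h : ∀ b ∈ basisOrbits, ∃ i : Fin 8, basisOrbits.getD i 0 = b := by decide +kernel
    intro b hb
    obtain ⟨i, rfl⟩ := h b hb
    exact Submodule.mem_sup_left (Submodule.subset_span ⟨i, rfl⟩)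
  · have h : ∀ L ∈ relations, ∀ d ∈ L, d.deg < 23 := by decide +kernel
    exact fun L hL d hd => Submodule.mem_sup_right (orbitSum_hitTerms_mem hζ d (h L hL d hd))

/-! ### Averaging over the normalizer of the Singer cycle -/

/-- The exponent vector of a finitely supported function. -/
def Expo.ofFinsupp (d : Fin 5 →₀ ℕ) : Expo := (d 0, d 1, d 2, d 3, d 4)

theorem Expo.toFinsupp_ofFinsupp (d : Fin 5 →₀ ℕ) : (Expo.ofFinsupp d).toFinsupp = d := by
  ext j
  fin_cases j <;> simp [toFinsupp, get, ofFinsupp]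

omit [Algebra (ZMod 2) K] in
theorem sum_pow_zeta {ζ : K} (hζ : ζ ^ 5 = ζ ^ 2 + 1) (w : ℕ) :
    ∑ n ∈ range 31, (ζ ^ n) ^ w = if 31 ∣ w then 1 else 0 := by
  have h2 : (2 : K) = 0 := CharTwo.two_eq_zero
  simp only [pow_right_comm ζ _ w]
  split_ifs with h
  · have h1 : ζ ^ w = 1 := by rwa [← orderOf_dvd_iff_pow_eq_one, orderOf_zeta hζ]
    simp only [h1, one_pow, sum_const, card_range, nsmul_eq_mul, mul_one]
    rw [show ((31 : ℕ) : K) = 2 * 15 + 1 by norm_num, h2, zero_mul, zero_add]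
  · have h1 : ζ ^ w ≠ 1 := by rwa [Ne, ← orderOf_dvd_iff_pow_eq_one, orderOf_zeta hζ]
    rw [geom_sum_eq h1, ← pow_mul, mul_comm, pow_mul, zeta_pow_thirtyOne hζ, one_pow, sub_self,
      zero_div]

theorem exists_sum_orbit {ζ : K} (hζ : ζ ^ 5 = ζ ^ 2 + 1) {p v : MvPolynomial (Fin 5) K}
    (hp : p.IsHomogeneous 23)
    (hv : ∀ q, IsFrame ζ q → frameMap q p - v ∈ hitSubmodule K) :
    ∃ c : Fin 8 → K, ∀ q, IsFrame ζ q →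
      frameMap q (∑ i, c i • orbit K (basisOrbits.getD i 0)) - v ∈ hitSubmodule K := by
  have h2 : (2 : K) = 0 := CharTwo.two_eq_zero
  set S := p.support.filter fun d => 31 ∣ (Expo.ofFinsupp d).weight with hS
  set p₁ := ∑ d ∈ S, coeff d p • (Expo.ofFinsupp d).mono K with hp₁
  set p₂ := ∑ d ∈ S, coeff d p • orbit K (Expo.ofFinsupp d) with hp₂
  have hsum : p = ∑ d ∈ p.support, coeff d p • (Expo.ofFinsupp d).mono K := by
    conv_lhs => rw [p.as_sum]
    refine sum_congr rfl fun d _ => ?_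
    rw [Expo.mono_eq, Expo.toFinsupp_ofFinsupp, smul_monomial, smul_eq_mul, mul_one]
  have h₁ : ∀ q, frameMap q p₁ = ∑ n ∈ range 31, frameMap (ζ ^ n • q) p := by
    intro q
    conv_rhs => rw [hsum]
    simp only [map_sum, map_smul, frameMap_smul_mono]
    rw [sum_comm, hp₁, hS, sum_filter, map_sum]
    refine sum_congr rfl fun d _ => ?_
    rw [← smul_sum, ← sum_smul, sum_pow_zeta hζ]
    split_ifs <;> simp
  have h₂ : ∀ q, IsFrame ζ q →
      frameMap q p₂ = ∑ j ∈ range 5, frameMap (fun k => q k ^ 2 ^ j) p₁ := by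
    intro q hq
    simp only [hp₁, hp₂, map_sum, map_smul, frameMap_orbit hζ hq]
    rw [sum_comm]
    simp only [smul_sum]
  have hv₁ : ∀ q, IsFrame ζ q → frameMap q p₁ - v ∈ hitSubmodule K := by
    intro q hq
    have h := sum_mem (t := range 31) fun n _ => hv _ (hq.pow_smul hζ n)
    rw [sum_sub_distrib, ← h₁] at h
    convert h using 2
    rw [sum_const, card_range, ← Nat.cast_smul_eq_nsmul K,
      show ((31 : ℕ) : K) = 2 * 15 + 1 by norm_num, h2, zero_mul, zero_add, one_smul]
  have hv₂ : ∀ q, IsFrame ζ q → frameMap q p₂ - v ∈ hitSubmodule K := by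
    intro q hq
    have h := sum_mem (t := range 5) fun j _ => hv₁ _ (hq.pow_two_pow hζ j)
    rw [sum_sub_distrib, ← h₂ q hq] at h
    convert h using 2
    rw [sum_const, card_range, ← Nat.cast_smul_eq_nsmul K,
      show ((5 : ℕ) : K) = 2 * 2 + 1 by norm_num, h2, zero_mul, zero_add, one_smul]
  have hmem : p₂ ∈ Submodule.span K (Set.range fun i : Fin 8 => orbit K (basisOrbits.getD i 0)) ⊔
      frameKernel ζ := by
    refine sum_mem fun d hd => Submodule.smul_mem _ _ ?_
    rw [hS, mem_filter] at hd
    refine orbit_mem_span_sup hζ _ ?_ hd.2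
    rw [← Expo.degree_toFinsupp, Expo.toFinsupp_ofFinsupp, Finsupp.degree_eq_weight_one]
    exact hp (mem_support_iff.mp hd.1)
  obtain ⟨s, hs, r, hr, hsr⟩ := Submodule.mem_sup.mp hmem
  obtain ⟨c, rfl⟩ := (Submodule.mem_span_range_iff_exists_fun K).mp hs
  refine ⟨c, fun q hq => ?_⟩
  have h := sub_mem (hv₂ q hq) (mem_frameKernel.mp hr q hq)
  rw [← hsr, map_add] at h
  convert h using 1
  abel

end Orbit

section Coefficient

variable {K : Type*} [Field K]

/-! ### Coefficients of spikes -/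

theorem coeff_squareMap_monomial_of_spike [CharP K 2] (d e : Fin 5 →₀ ℕ)
    (he : ∀ j, e j ∈ ({0, 1, 3, 7, 15} : Finset ℕ)) (hd : d.degree < e.degree) :
    coeff e (squareMap K (monomial d 1)) = 0 := by
  have hchoose : ∀ s ∈ ({0, 1, 3, 7, 15} : Finset ℕ), ∀ i ∈ range (s + 1), i ≠ 0 →
      2 ∣ (s - i).choose i := by decide +kernel
  have hX : ∀ j, ((X j + X j ^ 2) ^ d j : MvPolynomial (Fin 5) K) =
      ∑ i ∈ range (d j + 1), C ((d j).choose i : K) * X j ^ (d j + i) := by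
    intro j
    rw [show (X j + X j ^ 2 : MvPolynomial (Fin 5) K) = X j * (X j + 1) by ring, mul_pow,
      add_pow, mul_sum]
    refine sum_congr rfl fun i _ => ?_
    simp only [one_pow, mul_one, pow_add, map_natCast]
    ring
  rw [squareMap, aeval_monomial, map_one, one_mul, Finsupp.prod_fintype _ _ (by simp)]
  simp only [hX]
  rw [prod_univ_sum, coeff_sum]
  refine sum_eq_zero fun φ _ => ?_
  rw [prod_mul_distrib, ← map_prod C, coeff_C_mul]
  have hmono : (∏ j, X j ^ (d j + φ j) : MvPolynomial (Fin 5) K) =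
      monomial (d + Finsupp.equivFunOnFinite.symm φ) 1 := by
    rw [monomial_eq, Finsupp.prod_fintype _ _ (by simp)]
    simp
  rw [hmono, coeff_monomial]
  split_ifs with h
  · obtain ⟨j, hj⟩ : ∃ j, φ j ≠ 0 := by
      by_contra! hφ
      rw [← h] at hd
      have : Finsupp.equivFunOnFinite.symm φ = 0 := by
        ext j
        simp [hφ j]
      simp [this] at hd
    have hej : d j + φ j = e j := by simp [← h]
    have h2 := hchoose (e j) (he j) (φ j) (by rw [mem_range]; lia) hj
    rw [show e j - φ j = d j by lia] at h2
    rw [prod_eq_zero (mem_univ j) ((CharP.cast_eq_zero_iff K 2 _).mpr h2), zero_mul]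
  · rw [mul_zero]

theorem coeff_eq_zero_of_mem_hitSubmodule [CharP K 2] {u : MvPolynomial (Fin 5) K}
    (hu : u ∈ hitSubmodule K) (e : Fin 5 →₀ ℕ) (he : ∀ j, e j ∈ ({0, 1, 3, 7, 15} : Finset ℕ))
    (hdeg : e.degree = 23) : coeff e u = 0 := by
  induction hu using Submodule.span_induction with
  | mem u hu =>
    obtain ⟨d, hd, rfl⟩ := hu
    rw [coeff_homogeneousComponent, coeff_squareMap_monomial_of_spike d e he (hdeg ▸ hd), ite_self]
  | zero => simp
  | add u v _ _ hu hv => rw [coeff_add, hu, hv, add_zero]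
  | smul c u _ hu => rw [coeff_smul, hu, smul_zero]

/-! ### Coefficients of the images of orbits -/

/-- The `2 ^ b`-th power of the `j`-th linear form of the frame `ζ ^ l k`. -/
def frameFactor (ζ : K) (l : Expo) (f : ℕ × ℕ) : MvPolynomial (Fin 5) K :=
  ∑ k, C (ζ ^ (l.get k * 2 ^ (f.1 + f.2))) * X k ^ 2 ^ f.2

theorem frameFactor_eq [CharP K 2] (ζ : K) (l : Expo) (j b : ℕ) :
    frameFactor ζ l (j, b) = frameFactor ζ l (j, 0) ^ 2 ^ b := by
  rw [frameFactor, frameFactor, sum_pow_char_pow]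
  refine sum_congr rfl fun k _ => ?_
  simp only [mul_pow, ← map_pow C, ← pow_mul, pow_add, pow_zero, mul_one, one_mul, mul_assoc]

theorem prod_oddFactor [CharP K 2] (ζ : K) (l : Expo) (j b a : ℕ) :
    ((oddFactor j b a).map (frameFactor ζ l)).prod =
      frameFactor ζ l (j, 0) ^ (a % 2 * 2 ^ b) := by
  unfold oddFactor
  obtain h | h := Nat.mod_two_eq_zero_or_one a <;> simp [h, frameFactor_eq ζ l j b, Nat.beq]

theorem prod_digitList [CharP K 2] (ζ : K) (l : Expo) (n i : ℕ) (m : Expo)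
    (hm : ∀ j, m.get j < 2 ^ n) :
    ((digitList n i m).map (frameFactor ζ l)).prod =
      ∏ j : Fin 5, frameFactor ζ l (j, 0) ^ (m.get j * 2 ^ i) := by
  induction n generalizing i m with
  | zero =>
    have h0 : ∀ j, m.get j = 0 := fun j => by simpa using hm j
    simp [digitList, h0]
  | succ n ih =>
    obtain ⟨a, b, c, d, e⟩ := m
    have hlt : ∀ j, Expo.get (a / 2, b / 2, c / 2, d / 2, e / 2) j < 2 ^ n := by
      intro j
      have := hm j
      fin_cases j <;> simp [Expo.get, pow_succ] at this ⊢ <;> lia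
    have hsplit : ∀ (L : MvPolynomial (Fin 5) K) (t : ℕ),
        L ^ (t * 2 ^ i) = L ^ (t / 2 * 2 ^ (i + 1)) * L ^ (t % 2 * 2 ^ i) := by
      intro L t
      rw [← pow_add]
      congr 1
      conv_lhs => rw [← Nat.div_add_mod t 2]
      ring
    simp only [digitList, List.map_append, List.prod_append, ih _ _ hlt, prod_oddFactor]
    simp only [Fin.prod_univ_five, Expo.get, Matrix.cons_val]
    rw [hsplit _ a, hsplit _ b, hsplit _ c, hsplit _ d, hsplit _ e]
    simp only [Fin.coe_ofNat_eq_mod, Nat.reduceMod]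
    ring

theorem coeff_frameFactor_mul (ζ : K) (l : Expo) (j b : ℕ) (p : MvPolynomial (Fin 5) K)
    (e : Fin 5 →₀ ℕ) :
    coeff e (frameFactor ζ l (j, b) * p) = ∑ k, if 2 ^ b ≤ e k then
      ζ ^ (l.get k * 2 ^ (j + b)) * coeff (e - Finsupp.single k (2 ^ b)) p else 0 := by
  simp only [frameFactor, sum_mul, coeff_sum, C_mul_X_pow_eq_monomial, coeff_monomial_mul',
    Finsupp.single_le_iff]

theorem sum_map_bif (ζ : K) (c : Bool) (s : ℕ) (L : List ℕ) :
    ((bif c then L.map (s + ·) else []).map (ζ ^ ·)).sum =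
      if c then ζ ^ s * (L.map (ζ ^ ·)).sum else 0 := by
  cases c
  · simp
  · simp [← List.sum_map_mul_left, Function.comp_def, pow_add]

theorem coeff_prod_frameFactor (ζ : K) (l : Expo) (fs : List (ℕ × ℕ)) (e : Expo) :
    coeff e.toFinsupp ((fs.map (frameFactor ζ l)).prod) =
      ((coeffList l fs e).map (ζ ^ ·)).sum := by
  induction fs generalizing e with
  | nil =>
    have h : e.toFinsupp = 0 ↔ e.deg = 0 := by
      rw [← Finsupp.degree_eq_zero_iff, Expo.degree_toFinsupp]
    rw [List.map_nil, List.prod_nil, coeff_one, coeffList]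
    by_cases h0 : e.deg = 0
    · simp [h0, h.mpr h0]
    · have : Nat.beq e.deg 0 = false :=
        Bool.eq_false_iff.mpr fun h' => h0 (Nat.eq_of_beq_eq_true h')
      simp [this, Ne.symm (mt h.mp h0)]
  | cons f fs ih =>
    obtain ⟨j, b⟩ := f
    obtain ⟨e₀, e₁, e₂, e₃, e₄⟩ := e
    have hsub : ∀ k, Expo.toFinsupp (e₀, e₁, e₂, e₃, e₄) - Finsupp.single k (2 ^ b) =
        Expo.toFinsupp (![(e₀ - 2 ^ b, e₁, e₂, e₃, e₄), (e₀, e₁ - 2 ^ b, e₂, e₃, e₄),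
          (e₀, e₁, e₂ - 2 ^ b, e₃, e₄), (e₀, e₁, e₂, e₃ - 2 ^ b, e₄),
          (e₀, e₁, e₂, e₃, e₄ - 2 ^ b)] k) := by
      intro k
      ext i
      fin_cases k <;> fin_cases i <;> simp [Expo.toFinsupp, Expo.get]
    rw [List.map_cons, List.prod_cons, coeff_frameFactor_mul]
    simp only [hsub, ih, Fin.sum_univ_five]
    simp only [coeffList, List.map_append, List.sum_append, sum_map_bif, Nat.ble_eq]
    simp [Expo.toFinsupp, Expo.get, add_assoc]

variable [CharP K 2]

theorem coeff_frameMap_mono (ζ : K) (l m e : Expo) (hm : m.deg < 32) :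
    coeff e.toFinsupp (frameMap (fun k => ζ ^ l.get k) (m.mono K)) =
      ((coeffList l (digitList 5 0 m) e).map (ζ ^ ·)).sum := by
  have hlt : ∀ j, m.get j < 2 ^ 5 := by
    obtain ⟨a, b, c, d, e⟩ := m
    simp only [Expo.deg] at hm
    intro j
    fin_cases j <;> simp [Expo.get] <;> lia
  rw [← coeff_prod_frameFactor, prod_digitList ζ l 5 0 m hlt, frameMap_mono]
  simp [frameFactor, pow_mul]

theorem coeff_frameMap_orbit {ζ : K} (hζ : ζ ^ 5 = ζ ^ 2 + 1) (l m e : Expo) (hm : m.deg < 32) :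
    coeff e.toFinsupp (frameMap (fun k => ζ ^ l.get k) (orbit K m)) =
      maskEval ζ (zetaSum (orbitCoeffList l e m)) := by
  have hrot : ∀ n : Expo, n.deg < 32 → n.rot.deg < 32 := by
    rintro ⟨a, b, c, d, e⟩ h
    simp only [Expo.deg, Expo.rot] at h ⊢
    lia
  have h₁ := hrot _ hm
  have h₂ := hrot _ h₁
  have h₃ := hrot _ h₂
  have h₄ := hrot _ h₃
  rw [← sum_map_zeta_pow hζ, orbitCoeffList]
  simp only [List.map_append, List.sum_append, orbit, map_add, coeff_add,
    coeff_frameMap_mono ζ l _ e hm, coeff_frameMap_mono ζ l _ e h₁, coeff_frameMap_mono ζ l _ e h₂,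
    coeff_frameMap_mono ζ l _ e h₃, coeff_frameMap_mono ζ l _ e h₄]
  ring

theorem coeff_frameMap_sum_orbit {ζ : K} (hζ : ζ ^ 5 = ζ ^ 2 + 1) (e : Expo)
    {F : List (Expo × Expo × ℕ)} (hF : checkFrames e F = true) {l n : Expo} {r : ℕ}
    (hl : (l, n, r) ∈ F) (c : Fin 8 → K) :
    coeff e.toFinsupp
        (frameMap (fun k => ζ ^ l.get k) (∑ i, c i • orbit K (basisOrbits.getD i 0))) =
      ∑ i, c i * if r.testBit i then 1 else 0 := by
  have hdeg : ∀ i : Fin 8, (basisOrbits.getD i 0).deg < 32 := by decide +kernel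
  simp only [checkFrames, List.all_eq_true, List.mem_range] at hF
  have h := hF _ hl
  rw [map_sum, coeff_sum]
  refine sum_congr rfl fun i _ => ?_
  have hi := Nat.eq_of_beq_eq_true (h i i.2)
  simp only at hi
  rw [map_smul, coeff_smul, coeff_frameMap_orbit hζ _ _ _ (hdeg i), hi, smul_eq_mul]
  congr 1
  rw [Nat.testBit_eq_decide_div_mod_eq]
  obtain h0 | h0 := Nat.mod_two_eq_zero_or_one (r / 2 ^ (i : ℕ)) <;>
    simp [h0, maskEval, sum_range_succ, Nat.testBit]

variable [Algebra (ZMod 2) K]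

/-- The frames listed in `F` are given by invertible matrices. -/
def invertibleFrames (F : List (Expo × Expo × ℕ)) : Prop :=
  ∀ f ∈ F, bitMatrix (fun k => zetaPow (f.1.get k)) * (bitMatrix f.2.1.get).transpose = 1

theorem sum_testBit_eq_coeff {ζ : K} (hζ : ζ ^ 5 = ζ ^ 2 + 1) {v : MvPolynomial (Fin 5) K}
    {c : Fin 8 → K}
    (hc : ∀ q, IsFrame ζ q →
      frameMap q (∑ i, c i • orbit K (basisOrbits.getD i 0)) - v ∈ hitSubmodule K) (e : Expo)
    (he : ∀ j, e.get j ∈ ({0, 1, 3, 7, 15} : Finset ℕ)) (hdeg : e.deg = 23)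
    {F : List (Expo × Expo × ℕ)} (hF : checkFrames e F = true) (hF' : invertibleFrames F)
    {f : Expo × Expo × ℕ} (hf : f ∈ F) :
    (∑ i : Fin 8, c i * if f.2.2.testBit i then 1 else 0) = coeff e.toFinsupp v := by
  have h := coeff_eq_zero_of_mem_hitSubmodule (hc _ (isFrame_pow hζ f.1 f.2.1 (hF' f hf)))
    e.toFinsupp he (e.degree_toFinsupp.trans hdeg)
  rw [coeff_sub, sub_eq_zero, coeff_frameMap_sum_orbit hζ e hF hf] at h
  exact h

theorem coefficients_eq_zero {ζ : K} (hζ : ζ ^ 5 = ζ ^ 2 + 1) {v : MvPolynomial (Fin 5) K}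
    {c : Fin 8 → K}
    (hc : ∀ q, IsFrame ζ q →
      frameMap q (∑ i, c i • orbit K (basisOrbits.getD i 0)) - v ∈ hitSubmodule K) : c = 0 := by
  have h2 : (2 : K) = 0 := CharTwo.two_eq_zero
  have h₁ : invertibleFrames framesThree := by unfold invertibleFrames; decide +kernel
  have h₂ : invertibleFrames framesFive := by unfold invertibleFrames; decide +kernel
  have k₁ : ∀ f ∈ framesThree, _ := fun f hf => sum_testBit_eq_coeff hζ hc (15, 7, 1, 0, 0)
    (by decide +kernel) rfl checkFrames_framesThree h₁ hf
  have k₂ : ∀ f ∈ framesFive, _ := fun f hf => sum_testBit_eq_coeff hζ hc (15, 3, 3, 1, 1)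
    (by decide +kernel) rfl checkFrames_framesFive h₂ hf
  simp [framesThree, framesFive, Fin.sum_univ_eight, Nat.testBit] at k₁ k₂
  obtain ⟨a₀, a₁, a₂, a₃, a₄, a₅, a₆⟩ := k₁
  obtain ⟨b₀, b₁, b₂⟩ := k₂
  ext i
  fin_cases i <;> simp <;> grind

end Coefficient

section Descent

variable {K : Type*} [Field K] [Algebra (ZMod 2) K]

/-! ### Extension of scalars -/

variable (K) in
/-- Extension of scalars from `F_2` to `K`. -/
def extendScalars : P5 →+* MvPolynomial (Fin 5) K := MvPolynomial.map (algebraMap (ZMod 2) K)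

theorem coeff_extendScalars (d : Fin 5 →₀ ℕ) (f : P5) :
    coeff d (extendScalars K f) = algebraMap (ZMod 2) K (coeff d f) := coeff_map _ _ _

theorem homogeneousComponent_extendScalars (n : ℕ) (f : P5) :
    homogeneousComponent n (extendScalars K f) = extendScalars K (homogeneousComponent n f) := by
  ext d
  simp only [coeff_homogeneousComponent, coeff_extendScalars]
  split_ifs <;> simp

theorem squareMap_extendScalars (f : P5) :
    squareMap K (extendScalars K f) = extendScalars K (Sq f) := by
  have h : (squareMap K : MvPolynomial (Fin 5) K →+* MvPolynomial (Fin 5) K).comp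
      (extendScalars K) = (extendScalars K).comp (Sq : P5 →+* P5) := by
    refine MvPolynomial.ringHom_ext (fun r => ?_) fun i => ?_ <;>
      simp [extendScalars, squareMap, Sq, algebraMap_eq]
  exact DFunLike.congr_fun h f

theorem extendScalars_mem_hitSubmodule {f : P5} (hf : IsHit 23 f) :
    extendScalars K f ∈ hitSubmodule K := by
  obtain ⟨g, hg, rfl⟩ := hf
  rw [← homogeneousComponent_extendScalars, ← squareMap_extendScalars]
  refine homogeneousComponent_squareMap_mem _ fun d hd => ?_
  by_contra! h
  have h' := congrArg (coeff d) (hg _ h)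
  rw [coeff_homogeneousComponent, if_pos rfl, coeff_zero] at h'
  rw [mem_support_iff, coeff_extendScalars, h', map_zero] at hd
  exact hd rfl

theorem isHit_of_mem_span {f : P5}
    (hf : f ∈ Submodule.span (ZMod 2) {u | ∃ d : Fin 5 →₀ ℕ, d.degree < 23 ∧
      u = homogeneousComponent 23 (Sq (monomial d 1))}) : IsHit 23 f := by
  induction hf using Submodule.span_induction with
  | mem u hu =>
    obtain ⟨d, hd, rfl⟩ := hu
    refine ⟨monomial d 1, fun m hm => ?_, rfl⟩
    rw [homogeneousComponent_of_mem (isHomogeneous_monomial 1 rfl), if_neg (by lia)]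
  | zero => exact ⟨0, by simp, by simp⟩
  | add u v _ _ hu hv =>
    obtain ⟨g, hg, rfl⟩ := hu
    obtain ⟨h, hh, rfl⟩ := hv
    exact ⟨g + h, fun m hm => by rw [map_add, hg m hm, hh m hm, add_zero], by simp⟩
  | smul c u _ hu =>
    obtain ⟨g, hg, rfl⟩ := hu
    exact ⟨c • g, fun m hm => by rw [map_smul, hg m hm, smul_zero], by simp⟩

theorem exists_mem_span_coeff_eq {u : MvPolynomial (Fin 5) K} (hu : u ∈ hitSubmodule K)
    (φ : K →ₗ[ZMod 2] ZMod 2) :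
    ∃ h ∈ Submodule.span (ZMod 2) {u | ∃ d : Fin 5 →₀ ℕ, d.degree < 23 ∧
      u = homogeneousComponent 23 (Sq (monomial d 1))}, ∀ m, coeff m h = φ (coeff m u) := by
  induction hu using Submodule.span_induction generalizing φ with
  | mem u hu =>
    obtain ⟨d, hd, rfl⟩ := hu
    refine ⟨φ 1 • homogeneousComponent 23 (Sq (monomial d 1)),
      Submodule.smul_mem _ _ (Submodule.subset_span ⟨d, hd, rfl⟩), fun m => ?_⟩
    have h : monomial d (1 : K) = extendScalars K (monomial d 1) := by simp [extendScalars]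
    rw [h, squareMap_extendScalars, homogeneousComponent_extendScalars, coeff_extendScalars,
      Algebra.algebraMap_eq_smul_one, map_smul, coeff_smul, smul_eq_mul, smul_eq_mul, mul_comm]
  | zero => exact ⟨0, Submodule.zero_mem _, by simp⟩
  | add u v _ _ hu hv =>
    obtain ⟨g, hg, hg'⟩ := hu φ
    obtain ⟨h, hh, hh'⟩ := hv φ
    exact ⟨g + h, Submodule.add_mem _ hg hh, fun m => by
      rw [coeff_add, coeff_add, hg', hh', map_add]⟩
  | smul c u _ hu =>
    obtain ⟨g, hg, hg'⟩ := hu (φ ∘ₗ LinearMap.mulLeft (ZMod 2) c)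
    exact ⟨g, hg, fun m => by rw [hg']; simp⟩

theorem isHit_of_extendScalars_mem {f : P5} (hf : extendScalars K f ∈ hitSubmodule K) :
    IsHit 23 f := by
  obtain ⟨φ, hφ⟩ := (Algebra.linearMap (ZMod 2) K).exists_leftInverse_of_injective
    (LinearMap.ker_eq_bot.mpr (algebraMap (ZMod 2) K).injective)
  obtain ⟨h, hh, hcoeff⟩ := exists_mem_span_coeff_eq hf φ
  obtain rfl : h = f := by
    ext d
    rw [hcoeff, coeff_extendScalars]
    exact LinearMap.congr_fun hφ (coeff d f)
  exact isHit_of_mem_span hh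

/-! ### Comparison of coordinates -/

/-- The exponents of `ζ` in the basis dual to `1, ζ, ..., ζ ^ 4` for the trace form. -/
def dualBasis : Expo := (26, 25, 29, 28, 27)

/-- The change of coordinates inverse to the frame `1, ζ, ..., ζ ^ 4`. -/
def traceMap (ζ : K) : MvPolynomial (Fin 5) K →ₐ[K] MvPolynomial (Fin 5) K :=
  aeval fun i => ∑ j : Fin 5, C (ζ ^ (dualBasis.get i * 2 ^ (j : ℕ))) * X j

omit [Algebra (ZMod 2) K] in
theorem isHomogeneous_traceMap (ζ : K) {p : MvPolynomial (Fin 5) K} {n : ℕ}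
    (hp : p.IsHomogeneous n) : (traceMap ζ p).IsHomogeneous n := by
  have h : ∀ i : Fin 5,
      (∑ j : Fin 5, C (ζ ^ (dualBasis.get i * 2 ^ (j : ℕ))) * X j).IsHomogeneous 1 := fun i =>
    IsHomogeneous.sum _ _ _ fun j _ => isHomogeneous_C_mul_X _ _
  have h' := hp.aeval _ h
  rwa [one_mul] at h'

variable [CharP K 2]

omit [Algebra (ZMod 2) K] in
theorem sum_dualBasis {ζ : K} (hζ : ζ ^ 5 = ζ ^ 2 + 1) (i n : Fin 5) :
    ∑ j : Fin 5, ζ ^ (dualBasis.get i * 2 ^ (j : ℕ)) * (ζ ^ (n : ℕ)) ^ 2 ^ (j : ℕ) =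
      if i = n then 1 else 0 := by
  have h : ∀ i n : Fin 5, zetaSum ((List.range 5).map fun j =>
      (dualBasis.get i + n) * 2 ^ j) = if i = n then 1 else 0 := by decide +kernel
  have h' := sum_map_zeta_pow hζ ((List.range 5).map fun j => (dualBasis.get i + n) * 2 ^ j)
  rw [h] at h'
  have hr : List.range 5 = [0, 1, 2, 3, 4] := rfl
  simp only [hr, List.map_cons, List.map_nil, List.sum_cons, List.sum_nil, add_zero] at h'
  simp only [← pow_mul, ← pow_add, ← add_mul, Fin.sum_univ_five, Fin.coe_ofNat_eq_mod,
    Nat.reduceMod]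
  rw [show (if i = n then 1 else 0 : K) = maskEval ζ (if i = n then 1 else 0) by
    split_ifs <;> simp [maskEval, sum_range_succ, Nat.testBit], ← h']
  ring

theorem frameMap_traceMap {ζ : K} (hζ : ζ ^ 5 = ζ ^ 2 + 1) {q : Fin 5 → K} (hq : IsFrame ζ q) :
    ∃ g : Matrix.GeneralLinearGroup (Fin 5) (ZMod 2), ∀ f : P5,
      frameMap q (traceMap ζ (extendScalars K f)) = extendScalars K (actGL g f) := by
  obtain ⟨g, hg⟩ := hq
  refine ⟨⟨g.1.transpose, g⁻¹.1.transpose, by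
    rw [← Matrix.transpose_mul, ← Units.val_mul, inv_mul_cancel, Units.val_one,
      Matrix.transpose_one], by
    rw [← Matrix.transpose_mul, ← Units.val_mul, mul_inv_cancel, Units.val_one,
      Matrix.transpose_one]⟩, fun f => DFunLike.congr_fun (?_ : ((frameMap q).comp
    (traceMap ζ) : MvPolynomial (Fin 5) K →+* _).comp (extendScalars K) =
      (extendScalars K).comp (actGL _ : P5 →+* P5)) f⟩
  have hpow : ∀ k (j : Fin 5), q k ^ 2 ^ (j : ℕ) =
      ∑ n : Fin 5, algebraMap (ZMod 2) K (g.1 k n) * (ζ ^ (n : ℕ)) ^ 2 ^ (j : ℕ) := by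
    intro k j
    rw [hg, sum_pow_char_pow]
    refine sum_congr rfl fun n _ => ?_
    rw [mul_pow, algebraMap_pow _ (by positivity)]
  have hcoord : ∀ k i, ∑ j : Fin 5, ζ ^ (dualBasis.get i * 2 ^ (j : ℕ)) * q k ^ 2 ^ (j : ℕ) =
      algebraMap (ZMod 2) K (g.1 k i) := by
    intro k i
    simp only [hpow, mul_sum, mul_left_comm _ (algebraMap (ZMod 2) K _)]
    rw [sum_comm]
    simp only [← mul_sum, sum_dualBasis hζ]
    simp
  refine MvPolynomial.ringHom_ext (fun r => ?_) fun i => ?_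
  · simp [extendScalars, algebraMap_eq]
  · have hL : frameMap q (traceMap ζ (X i)) = ∑ k, C (algebraMap (ZMod 2) K (g.1 k i)) * X k := by
      simp only [traceMap, frameMap, aeval_X, map_sum, map_mul, algHom_C, algebraMap_eq, mul_sum,
        ← hcoord, sum_mul]
      rw [sum_comm]
      simp only [← mul_assoc]
    simpa [extendScalars, actGL, smul_eq_C_mul] using hL

omit [Algebra (ZMod 2) K] in
theorem exists_zeta [IsAlgClosed K] : ∃ ζ : K, ζ ^ 5 = ζ ^ 2 + 1 := by
  have h2 : (2 : K) = 0 := CharTwo.two_eq_zero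
  obtain ⟨ζ, hζ⟩ := IsAlgClosed.exists_root
    (Polynomial.X ^ 5 + Polynomial.X ^ 2 + 1 : Polynomial K) (by
      have : (Polynomial.X ^ 5 + Polynomial.X ^ 2 + 1 : Polynomial K).degree = 5 := by
        compute_degree!
      simp [this])
  refine ⟨ζ, ?_⟩
  simp only [Polynomial.IsRoot, Polynomial.eval_add, Polynomial.eval_pow, Polynomial.eval_X,
    Polynomial.eval_one] at hζ
  linear_combination hζ - (ζ ^ 2 + 1) * h2

end Descent

/-- The GL_5-invariants of (QP_5)_23 vanish. -/
theorem stmt6 (f : P5)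
    (hf : f ∈ homogeneousSubmodule (Fin 5) (ZMod 2) 23)
    (hinv : ∀ g : Matrix.GeneralLinearGroup (Fin 5) (ZMod 2), IsHit 23 (actGL g f - f)) :
    IsHit 23 f := by
  let K := AlgebraicClosure (ZMod 2)
  have : CharP K 2 := charP_of_injective_algebraMap (algebraMap (ZMod 2) K).injective 2
  obtain ⟨ζ, hζ⟩ := exists_zeta (K := K)
  have hhom : (traceMap ζ (extendScalars K f)).IsHomogeneous 23 :=
    isHomogeneous_traceMap ζ (IsHomogeneous.map ((mem_homogeneousSubmodule 23 f).mp hf) _)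
  obtain ⟨c, hc⟩ := exists_sum_orbit hζ (v := extendScalars K f) hhom fun q hq => by
    obtain ⟨g, hg⟩ := frameMap_traceMap hζ hq
    rw [hg, ← map_sub]
    exact extendScalars_mem_hitSubmodule (hinv g)
  have hq : IsFrame ζ fun k => ∑ i : Fin 5,
      algebraMap (ZMod 2) K ((1 : Matrix.GeneralLinearGroup (Fin 5) (ZMod 2)).1 k i) *
        ζ ^ (i : ℕ) := ⟨1, fun _ => rfl⟩
  have h := hc _ hq
  rw [coefficients_eq_zero hζ hc] at h
  simp only [Pi.zero_apply, zero_smul, sum_const_zero, map_zero, zero_sub, neg_mem_iff] at h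
  exact isHit_of_extendScalars_mem h
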